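/- If 3 ≤ k ≤ r, then the maximum number of hyperedges in an n-vertex r-uniform hypergraph containing no Berge path of length k equals ⌊n/(r+1)⌋·(k−1) + ε, where ε = 1 if r+1 divides n+1 and ε = 0 otherwise. -/

import Mathlib

/-- A Berge path of length `k` in a hypergraph with hyperedge set `E`. -/
def IsBergePath {V : Type*} (E : Finset (Finset V)) (k : ℕ)
    (v : Fin (k + 1) → V) (h : Fin k → Finset V) : Prop :=
  Function.Injective v ∧ Function.Injective h ∧ (∀ i, h i ∈ E) ∧
    ∀ i : Fin k, v i.castSucc ∈ h i ∧ v i.succ ∈ h i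

def HasBergePath {V : Type*} (E : Finset (Finset V)) (k : ℕ) : Prop :=
  ∃ v h, IsBergePath E k v h

section IncidencePaths

variable {V : Type*}

/-- Incidence between vertices and hyperedges, as a symmetric relation on their disjoint union. -/
def Incident : V ⊕ Finset V → V ⊕ Finset V → Prop
  | .inl v, .inr e => v ∈ e
  | .inr e, .inl v => v ∈ e
  | _, _ => False

@[simp] theorem incident_inl_inr {v : V} {e : Finset V} :
    Incident (.inl v) (.inr e) ↔ v ∈ e := Iff.rfl

@[simp] theorem incident_inr_inl {v : V} {e : Finset V} :
    Incident (.inr e) (.inl v) ↔ v ∈ e := Iff.rfl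

@[simp] theorem not_incident_inl_inl {v w : V} : ¬ Incident (.inl v) (.inl w) := id

@[simp] theorem not_incident_inr_inr {e f : Finset V} : ¬ Incident (.inr e) (.inr f) := id

theorem Incident.symm {a b : V ⊕ Finset V} (h : Incident a b) : Incident b a := by
  rcases a with a | a <;> rcases b with b | b <;> exact h

theorem Incident.isLeft_eq {a b : V ⊕ Finset V} (h : Incident a b) : b.isLeft = !a.isLeft := by
  rcases a with a | a <;> rcases b with b | b <;> simp at h ⊢

/-- A path in the incidence graph of the hypergraph `E`, listed as an alternating sequence of
vertices and hyperedges. -/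
structure IsIncPath (E : Finset (Finset V)) (L : List (V ⊕ Finset V)) : Prop where
  isChain : L.IsChain Incident
  nodup : L.Nodup
  mem_of_mem : ∀ e, Sum.inr e ∈ L → e ∈ E

theorem IsIncPath.reverse {E : Finset (Finset V)} {L : List (V ⊕ Finset V)}
    (h : IsIncPath E L) : IsIncPath E L.reverse where
  isChain := by
    rw [List.isChain_reverse]
    exact h.isChain.imp fun _ _ h => h.symm
  nodup := List.nodup_reverse.2 h.nodup
  mem_of_mem e he := h.mem_of_mem e (List.mem_reverse.1 he)

theorem List.IsChain.isLeft_getElem {L : List (V ⊕ Finset V)} (hc : L.IsChain Incident)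
    {x : V} (hx : L.head? = some (.inl x)) (i : ℕ) (hi : i < L.length) :
    (L[i]).isLeft = decide (i % 2 = 0) := by
  induction i with
  | zero =>
    cases L with
    | nil => simp at hi
    | cons a L => simp at hx; simp [hx]
  | succ i ih =>
    have h1 := (List.isChain_iff_getElem.1 hc i hi).isLeft_eq
    rw [h1, ih (by omega)]
    rcases Nat.mod_two_eq_zero_or_one i with h | h <;> simp [h, Nat.add_mod]

theorem IsIncPath.hasBergePath {E : Finset (Finset V)} {L : List (V ⊕ Finset V)}
    (h : IsIncPath E L) {x : V} (hx : L.head? = some (.inl x)) {m : ℕ}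
    (hm : L.length = 2 * m + 1) : HasBergePath E m := by
  have hv : ∀ i : Fin (m + 1), ∃ v, L[2 * i.1]'(by omega) = .inl v := fun i => by
    have := h.isChain.isLeft_getElem hx (2 * i.1) (by omega)
    simpa [Sum.isLeft_iff] using this
  have he : ∀ i : Fin m, ∃ e, L[2 * i.1 + 1]'(by omega) = .inr e := fun i => by
    have := h.isChain.isLeft_getElem hx (2 * i.1 + 1) (by omega)
    simpa [Nat.add_mod, Sum.isRight_iff] using this
  choose v hv using hv
  choose e he using he
  refine ⟨v, e, fun i j hij => ?_, fun i j hij => ?_, fun i => ?_, fun i => ⟨?_, ?_⟩⟩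
  · have := (hv i).trans ((congrArg Sum.inl hij).trans (hv j).symm)
    have := (h.nodup.getElem_inj_iff).1 this
    omega
  · have := (he i).trans ((congrArg Sum.inr hij).trans (he j).symm)
    have := (h.nodup.getElem_inj_iff).1 this
    omega
  · exact h.mem_of_mem _ (he i ▸ List.getElem_mem _)
  · have := List.isChain_iff_getElem.1 h.isChain (2 * i.1) (by omega)
    rw [he i] at this
    have h2 := hv i.castSucc
    simp only [Fin.val_castSucc] at h2
    rw [h2] at this
    exact this
  · have := List.isChain_iff_getElem.1 h.isChain (2 * i.1 + 1) (by omega)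
    rw [he i] at this
    have h2 := hv i.succ
    simp only [Fin.val_succ, Nat.mul_add, Nat.mul_one] at h2
    simp only [Nat.add_assoc, Nat.reduceAdd] at this h2
    rw [h2] at this
    exact this

theorem List.IsChain.card_toLeft [DecidableEq V] {L : List (V ⊕ Finset V)}
    (hc : L.IsChain Incident) {m : ℕ} (hm : L.length ≤ 2 * m + 1) :
    L.toFinset.toLeft.card ≤ m + 1 := by
  induction m generalizing L with
  | zero =>
    calc _ ≤ L.toFinset.card := Finset.card_toLeft_le
      _ ≤ L.length := L.toFinset_card_le
      _ ≤ _ := hm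
  | succ m ih =>
    rcases L with _ | ⟨a, _ | ⟨b, L⟩⟩
    · simp [Finset.toLeft]
    · calc _ ≤ [a].toFinset.card := Finset.card_toLeft_le
        _ ≤ [a].length := List.toFinset_card_le _
        _ ≤ _ := by simp
    · have h1 := ih (L := L) (by simp at hc; exact hc.2.tail) (by simp at hm; omega)
      rcases a with a | a <;> rcases b with b | b <;> simp at hc ⊢
      · have := Finset.card_insert_le a L.toFinset.toLeft
        omega
      · have := Finset.card_insert_le b L.toFinset.toLeft
        omega

/-- In a hypergraph without longer Berge paths, the endpoint of a Berge path of length `m < r`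
lies only in hyperedges of the path. -/
theorem IsIncPath.inr_mem_of_head [DecidableEq V] {E : Finset (Finset V)} {r m : ℕ}
    (hE : ∀ e ∈ E, e.card = r) (hm : 1 ≤ m) (hmr : m + 1 ≤ r) (hno : ¬ HasBergePath E (m + 1))
    {L : List (V ⊕ Finset V)} (h : IsIncPath E L) (hl : L.length = 2 * m + 1)
    {x : V} (hx : L.head? = some (.inl x)) {e : Finset V} (he : e ∈ E) (hxe : x ∈ e) :
    Sum.inr e ∈ L := by
  by_contra heL
  by_cases hy : ∃ y ∈ e, Sum.inl y ∉ L
  · obtain ⟨y, hye, hyL⟩ := hy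
    refine hno (IsIncPath.hasBergePath (L := .inl y :: .inr e :: L) (x := y)
      ⟨?_, ?_, ?_⟩ rfl (by simp [hl]; omega))
    · rcases L with _ | ⟨a, L⟩
      · simp at hl
      · simp at hx
        subst hx
        simp [hye, hxe, h.isChain]
    · simp [hyL, heL, h.nodup]
    · intro f hf
      simp at hf
      rcases hf with rfl | hf
      · exact he
      · exact h.mem_of_mem f hf
  · push Not at hy
    have hsub : e ⊆ L.toFinset.toLeft := fun y hye => by simpa using hy y hye
    have heq : e = L.toFinset.toLeft := by
      refine Finset.eq_of_subset_of_card_le hsub ?_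
      rw [hE e he]
      exact (h.isChain.card_toLeft hl.le).trans hmr
    rcases L with _ | ⟨a, _ | ⟨b, T⟩⟩
    · simp at hl
    · simp at hl; omega
    simp at hx
    subst hx
    rcases b with b | b
    · have := h.isChain
      simp at this
    have hbE : b ∈ E := h.mem_of_mem b (by simp)
    have hbe : ¬ b ⊆ e := fun hbe => by
      have := Finset.eq_of_subset_of_card_le hbe (by rw [hE e he, hE b hbE])
      subst this
      simp at heL
    obtain ⟨z, hzb, hze⟩ := Finset.not_subset.1 hbe
    have hzL : Sum.inl z ∉ Sum.inl x :: Sum.inr b :: T := by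
      intro hz
      apply hze
      rw [heq]
      simpa using hz
    have hTne : T ≠ [] := by
      rintro rfl
      simp at hl
    have hc := h.isChain
    have hlast : ∃ w, T.getLast hTne = Sum.inl w := by
      have := h.isChain.isLeft_getElem (x := x) rfl (2 * m) (by omega)
      rw [← Sum.isLeft_iff]
      rw [List.getLast_eq_getElem]
      simp at hl
      have h3 : 2 * m = (T.length - 1) + 1 + 1 := by
        have := List.length_pos_iff.2 hTne
        omega
      simp only [h3] at this
      simp only [List.getElem_cons_succ] at this
      rw [this]
      simp
      omega
    obtain ⟨w, hw⟩ := hlast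
    have hwT : Sum.inl w ∈ T := hw ▸ List.getLast_mem hTne
    have hwe : w ∈ e := by
      rw [heq]
      simp [hwT]
    refine hno (IsIncPath.hasBergePath (L := .inl z :: .inr b :: (T ++ [.inr e, .inl x])) (x := z)
      ⟨?_, ?_, ?_⟩ rfl (by simp at hl ⊢; omega))
    · have h1 : (Sum.inr b :: T).IsChain Incident := hc.tail
      have h2 : ((Sum.inr b :: T) ++ [Sum.inr e, Sum.inl x]).IsChain Incident := by
        rw [List.isChain_append]
        refine ⟨h1, by simp [hxe], ?_⟩
        intro p hp q hq
        rw [List.getLast?_cons, List.getLast?_eq_getLast_of_ne_nil hTne, hw] at hp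
        simp at hp hq
        subst hp hq
        exact hwe
      rw [List.cons_append] at h2
      exact List.IsChain.cons_cons hzb h2
    · have := h.nodup
      simp at this hzL heL
      simp [List.nodup_append]
      grind only
    · intro f hf
      simp at hf
      rcases hf with rfl | hf | rfl
      · exact hbE
      · exact h.mem_of_mem f (by simp [hf])
      · exact he

/-- In a hypergraph without longer Berge paths, the hyperedges of a Berge cycle of length
`m < r` meet no other hyperedge. -/
theorem IsIncPath.inr_mem_of_cycle {E : Finset (Finset V)} {r m : ℕ}
    (hE : ∀ e ∈ E, e.card = r) (hm : 1 ≤ m) (hmr : m + 1 ≤ r) (hno : ¬ HasBergePath E (m + 1))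
    {C : List (V ⊕ Finset V)} (h : IsIncPath E C) (hl : C.length = 2 * m)
    (hcyc : Cycle.Chain Incident (C : Cycle (V ⊕ Finset V)))
    {w : V} {e f : Finset V} (heC : Sum.inr e ∈ C) (hwe : w ∈ e) (hf : f ∈ E) (hwf : w ∈ f) :
    Sum.inr f ∈ C := by
  classical
  have key : ∀ a ∈ C, ∃ M, (∀ b, b ∈ a :: M ↔ b ∈ C) ∧ (a :: M).Nodup ∧
      (a :: (M ++ [a])).IsChain Incident ∧ (a :: M).length = 2 * m := by
    intro a ha
    obtain ⟨A, B, rfl⟩ := List.append_of_mem ha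
    have hp : (a :: B ++ A).Perm (A ++ a :: B) := List.perm_append_comm
    refine ⟨B ++ A, fun b => hp.mem_iff, hp.nodup_iff.2 h.nodup, ?_, hp.length_eq.trans hl⟩
    have : ((A ++ a :: B : List _) : Cycle (V ⊕ Finset V)) = ((a :: B ++ A : List _) : Cycle _) :=
      Cycle.coe_eq_coe.2 List.isRotated_append
    rw [this, List.cons_append, Cycle.chain_coe_cons] at hcyc
    exact hcyc
  by_cases hw : Sum.inl w ∈ C
  · obtain ⟨M, hM, hnd, hch, hlen⟩ := key _ hw
    have hMne : M ≠ [] := by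
      rintro rfl
      simp at hlen
      omega
    have hch' : (Sum.inl w :: M).IsChain Incident :=
      (List.isChain_append.1 (by simpa using hch : ((Sum.inl w :: M) ++ [Sum.inl w]).IsChain _)).1
    obtain ⟨e', he'⟩ : ∃ e', M.getLast hMne = .inr e' := by
      have := (List.isChain_append.1
        (by simpa using hch : ((Sum.inl w :: M) ++ [Sum.inl w]).IsChain _)).2.2
      rw [List.getLast?_cons, List.getLast?_eq_getLast_of_ne_nil hMne] at this
      have := this (M.getLast hMne) (by simp) (.inl w) (by simp)
      rcases hx : M.getLast hMne with u | u
      · simp [hx] at this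
      · exact ⟨u, rfl⟩
    have he'M : Sum.inr e' ∈ M := he' ▸ List.getLast_mem hMne
    have he'E : e' ∈ E := h.mem_of_mem _ ((hM _).1 (by simp [he'M]))
    obtain ⟨z, hze, hzM⟩ : ∃ z ∈ e', Sum.inl z ∉ Sum.inl w :: M := by
      by_contra hcon
      push Not at hcon
      obtain ⟨M', rfl⟩ : ∃ M', M = M' ++ [Sum.inr e'] :=
        ⟨M.dropLast, by rw [← he', List.dropLast_append_getLast]⟩
      have hsub : e' ⊆ (Sum.inl w :: M').toFinset.toLeft := fun z hz => by
        have := hcon z hz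
        simpa using this
      have h1 := Finset.card_le_card hsub
      have h2 : (Sum.inl w :: M').IsChain Incident :=
        (List.isChain_append.1 (by simpa using hch' :
          ((Sum.inl w :: M') ++ [Sum.inr e']).IsChain _)).1
      have h3 := h2.card_toLeft (m := m - 1) (by simp at hlen ⊢; omega)
      rw [hE e' he'E] at h1
      omega
    rw [← hM]
    have hpath : IsIncPath E (Sum.inl w :: M ++ [Sum.inl z]) := by
      refine ⟨?_, ?_, ?_⟩
      · rw [List.isChain_append]
        refine ⟨hch', by simp, ?_⟩
        rw [List.getLast?_cons, List.getLast?_eq_getLast_of_ne_nil hMne, he']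
        simpa using hze
      · rw [List.nodup_append']
        exact ⟨hnd, by simp, by simpa using hzM⟩
      · intro g hg
        exact h.mem_of_mem g ((hM _).1 (by simpa using hg))
    have := hpath.inr_mem_of_head hE hm hmr hno (by simp at hlen ⊢; omega) (x := w) (by simp) hf hwf
    simpa using this
  · obtain ⟨M, hM, hnd, hch, hlen⟩ := key _ heC
    rw [← hM]
    have hpath : IsIncPath E (Sum.inl w :: Sum.inr e :: M) := by
      refine ⟨?_, ?_, ?_⟩
      · refine List.IsChain.cons_cons hwe ?_
        exact (List.isChain_append.1 (by simpa using hch :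
          ((Sum.inr e :: M) ++ [Sum.inr e]).IsChain _)).1
      · rw [List.nodup_cons, hM]
        exact ⟨hw, hnd⟩
      · intro g hg
        exact h.mem_of_mem g ((hM _).1 (by simpa using hg))
    have := hpath.inr_mem_of_head hE hm hmr hno (by simp at hlen ⊢; omega) (x := w) (by simp) hf hwf
    simpa using this

/-- The alternating list `v i, h i, v (i + 1), …, h (j - 1), v j`. -/
def incSegment (v : ℕ → V) (h : ℕ → Finset V) (i j : ℕ) : List (V ⊕ Finset V) :=
  .inl (v i) :: (List.range' i (j - i)).flatMap fun t => [.inr (h t), .inl (v (t + 1))]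

section Segment

variable {v : ℕ → V} {h : ℕ → Finset V} {i j : ℕ}

theorem incSegment_self : incSegment v h i i = [.inl (v i)] := by
  simp [incSegment]

theorem incSegment_succ (hij : i ≤ j) : incSegment v h i (j + 1) =
    incSegment v h i j ++ [Sum.inr (h j), .inl (v (j + 1))] := by
  have h1 : j + 1 - i = (j - i) + 1 := by omega
  simp [incSegment, h1, List.range'_concat, Nat.add_sub_cancel' hij]

theorem length_incSegment : (incSegment v h i j).length = 2 * (j - i) + 1 := by
  simp [incSegment, List.length_flatMap]
  omega

theorem head?_incSegment : (incSegment v h i j).head? = some (.inl (v i)) := by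
  simp [incSegment]

theorem getLast?_incSegment (hij : i ≤ j) :
    (incSegment v h i j).getLast? = some (.inl (v j)) := by
  induction j, hij using Nat.le_induction with
  | base => simp [incSegment_self]
  | succ j hij ih => simp [incSegment_succ hij]

theorem inl_mem_incSegment (hij : i ≤ j) {x : V} :
    Sum.inl x ∈ incSegment v h i j ↔ ∃ t, i ≤ t ∧ t ≤ j ∧ x = v t := by
  induction j, hij using Nat.le_induction with
  | base =>
    simp only [incSegment_self, List.mem_singleton, Sum.inl.injEq]
    constructor
    · exact fun h => ⟨i, le_rfl, le_rfl, h⟩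
    · rintro ⟨t, h1, h2, h3⟩
      rwa [le_antisymm h2 h1] at h3
  | succ j hij ih =>
    rw [incSegment_succ hij, List.mem_append, ih]
    simp only [List.mem_cons, reduceCtorEq, Sum.inl.injEq, List.not_mem_nil, or_false, false_or]
    grind

theorem inr_mem_incSegment (hij : i ≤ j) {e : Finset V} :
    Sum.inr e ∈ incSegment v h i j ↔ ∃ t, i ≤ t ∧ t < j ∧ e = h t := by
  induction j, hij using Nat.le_induction with
  | base =>
    simp only [incSegment_self, List.mem_singleton, reduceCtorEq, false_iff]
    rintro ⟨t, h1, h2, -⟩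
    omega
  | succ j hij ih =>
    rw [incSegment_succ hij, List.mem_append, ih]
    simp only [List.mem_cons, reduceCtorEq, Sum.inr.injEq, List.not_mem_nil, or_false]
    grind

theorem isChain_incSegment (hij : i ≤ j) (hl : ∀ t, i ≤ t → t < j → v t ∈ h t)
    (hr : ∀ t, i ≤ t → t < j → v (t + 1) ∈ h t) : (incSegment v h i j).IsChain Incident := by
  induction j, hij using Nat.le_induction with
  | base => simp [incSegment_self]
  | succ j hij ih =>
    rw [incSegment_succ hij, List.isChain_append, getLast?_incSegment hij]
    refine ⟨ih (fun t h1 h2 => hl t h1 (by omega)) (fun t h1 h2 => hr t h1 (by omega)), ?_, ?_⟩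
    · simpa using hr j hij (by omega)
    · simpa using hl j hij (by omega)

theorem nodup_incSegment (hij : i ≤ j)
    (hv : ∀ s t, i ≤ s → s < t → t ≤ j → v s ≠ v t)
    (hh : ∀ s t, i ≤ s → s < t → t < j → h s ≠ h t) : (incSegment v h i j).Nodup := by
  induction j, hij using Nat.le_induction with
  | base => simp [incSegment_self]
  | succ j hij ih =>
    rw [incSegment_succ hij, List.nodup_append']
    refine ⟨ih (fun s t h1 h2 h3 => hv s t h1 h2 (by omega))
      (fun s t h1 h2 h3 => hh s t h1 h2 (by omega)), by simp, ?_⟩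
    simp only [List.disjoint_cons_right, inr_mem_incSegment hij, inl_mem_incSegment hij,
      List.disjoint_nil_right, and_true]
    grind

end Segment

/-- The hyperedges `h 0, …, h (m - 1)` together with the interior vertices `v 1, …, v (m - 1)`
of a Berge path of length `m` in `E`. -/
structure IsBergeCore (E : Finset (Finset V)) (m : ℕ) (v : ℕ → V) (h : ℕ → Finset V) : Prop where
  mem_left : ∀ t, 1 ≤ t → t < m → v t ∈ h t
  mem_right : ∀ t, t + 1 < m → v (t + 1) ∈ h t
  ne : ∀ s t, 1 ≤ s → s < t → t < m → v s ≠ v t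
  edge_ne : ∀ s t, s < t → t < m → h s ≠ h t
  mem : ∀ t, t < m → h t ∈ E

namespace IsBergeCore

variable {E : Finset (Finset V)} {m i j : ℕ} {v : ℕ → V} {h : ℕ → Finset V} {x y z w : V}
  {g : Finset V}

theorem isChain_segment (H : IsBergeCore E m v h) (hi : 1 ≤ i) (hij : i ≤ j) (hj : j < m) :
    (incSegment v h i j).IsChain Incident :=
  isChain_incSegment hij (fun t h1 h2 => H.mem_left t (by omega) (by omega))
    (fun t h1 h2 => H.mem_right t (by omega))

theorem nodup_segment (H : IsBergeCore E m v h) (hi : 1 ≤ i) (hij : i ≤ j) (hj : j < m) :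
    (incSegment v h i j).Nodup :=
  nodup_incSegment hij (fun s t h1 h2 h3 => H.ne s t (by omega) h2 (by omega))
    (fun s t h1 h2 h3 => H.edge_ne s t h2 (by omega))

theorem isChain_reverse_segment (H : IsBergeCore E m v h) (hi : 1 ≤ i) (hij : i ≤ j)
    (hj : j < m) : (incSegment v h i j).reverse.IsChain Incident := by
  rw [List.isChain_reverse]
  exact (H.isChain_segment hi hij hj).imp fun _ _ h => h.symm

theorem injOn (H : IsBergeCore E m v h) (hi : 1 ≤ i) (him : i < m) (hj : 1 ≤ j) (hjm : j < m)
    (hij : v i = v j) : i = j := by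
  rcases lt_trichotomy i j with h1 | h1 | h1
  · exact absurd hij (H.ne i j hi h1 hjm)
  · exact h1
  · exact absurd hij.symm (H.ne j i hj h1 him)

theorem edge_injOn (H : IsBergeCore E m v h) (him : i < m) (hjm : j < m)
    (hij : h i = h j) : i = j := by
  rcases lt_trichotomy i j with h1 | h1 | h1
  · exact absurd hij (H.edge_ne i j h1 hjm)
  · exact h1
  · exact absurd hij.symm (H.edge_ne j i h1 him)

theorem isIncPath_first (H : IsBergeCore E m v h) (hm : 2 ≤ m) (hx : x ∈ h 0)
    (hxv : ∀ t, 1 ≤ t → t < m → x ≠ v t) :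
    IsIncPath E (.inl x :: .inr (h 0) :: (incSegment v h 1 (m - 1) ++ [.inr (h (m - 1))])) := by
  have hmm : m - 1 < m := by omega
  have h1 : 1 ≤ m - 1 := by omega
  refine ⟨?_, ?_, ?_⟩
  · refine .cons_cons hx ?_
    rw [List.isChain_cons, List.isChain_append]
    refine ⟨?_, H.isChain_segment le_rfl h1 hmm, by simp, ?_⟩
    · simpa [List.head?_append, head?_incSegment] using H.mem_right 0 (by omega)
    · simpa [getLast?_incSegment h1] using H.mem_left _ h1 hmm
  · have := H.nodup_segment le_rfl h1 hmm
    have := @H.edge_injOn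
    simp [List.nodup_append', inl_mem_incSegment h1, inr_mem_incSegment h1]
    and_intros <;> grind -ext
  · intro e he
    simp [inr_mem_incSegment h1] at he
    rcases he with rfl | ⟨t, -, ht, rfl⟩ | rfl
    · exact H.mem _ (by omega)
    · exact H.mem _ (by omega)
    · exact H.mem _ (by omega)

theorem isIncPath_rotate (H : IsBergeCore E m v h) (hi : 1 ≤ i) (him : i + 1 < m)
    (hi0 : v (i + 1) ∈ h 0) (hz : z ∈ h i) (hzv : ∀ t, 1 ≤ t → t < m → z ≠ v t) :
    IsIncPath E (.inl z :: .inr (h i) :: ((incSegment v h 1 i).reverse ++ .inr (h 0) ::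
      (incSegment v h (i + 1) (m - 1) ++ [.inr (h (m - 1))]))) := by
  have hmm : m - 1 < m := by omega
  have h1 : i + 1 ≤ m - 1 := by omega
  refine ⟨?_, ?_, ?_⟩
  · refine .cons_cons hz ?_
    rw [List.isChain_cons, List.isChain_append, List.isChain_cons, List.isChain_append]
    refine ⟨?_, H.isChain_reverse_segment le_rfl hi (by omega),
      ⟨?_, H.isChain_segment (by omega) h1 hmm, by simp, ?_⟩, ?_⟩
    · simpa [List.head?_append, getLast?_incSegment hi] using H.mem_left i hi (by omega)
    · simpa [List.head?_append, head?_incSegment] using hi0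
    · simpa [getLast?_incSegment h1] using H.mem_left _ (by omega) hmm
    · simpa [List.getLast?_reverse, head?_incSegment] using H.mem_right 0 (by omega)
  · have := H.nodup_segment le_rfl hi (by omega)
    have := H.nodup_segment (by omega) h1 hmm
    have := @H.edge_injOn
    have := @H.injOn
    simp [List.nodup_append', List.disjoint_left, inl_mem_incSegment, inr_mem_incSegment, h1, hi]
    and_intros <;> grind -ext
  · intro e he
    simp [inr_mem_incSegment, h1, hi] at he
    have := H.mem
    grind -ext

theorem isIncPath_insert (H : IsBergeCore E m v h) (hi : 1 ≤ i) (him : i + 1 < m)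
    (hz0 : z ∈ h 0) (hz : z ∈ h i) (hzv : ∀ t, 1 ≤ t → t < m → z ≠ v t)
    (hy : y ∈ h (m - 1)) (hyv : ∀ t, 1 ≤ t → t < m → y ≠ v t) (hyz : y ≠ z) :
    IsIncPath E ((incSegment v h 1 i).reverse ++ .inr (h 0) :: .inl z :: .inr (h i) ::
      (incSegment v h (i + 1) (m - 1) ++ [.inr (h (m - 1)), .inl y])) := by
  have hmm : m - 1 < m := by omega
  have h1 : i + 1 ≤ m - 1 := by omega
  refine ⟨?_, ?_, ?_⟩
  · rw [List.isChain_append, List.isChain_cons_cons, List.isChain_cons_cons, List.isChain_cons,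
      List.isChain_append]
    refine ⟨H.isChain_reverse_segment le_rfl hi (by omega), ⟨hz0, hz, ?_,
      H.isChain_segment (by omega) h1 hmm, by simpa, ?_⟩, ?_⟩
    · simpa [List.head?_append, head?_incSegment] using H.mem_right i (by omega)
    · simpa [getLast?_incSegment h1] using H.mem_left _ (by omega) hmm
    · simpa [List.getLast?_reverse, head?_incSegment] using H.mem_right 0 (by omega)
  · have := H.nodup_segment le_rfl hi (by omega)
    have := H.nodup_segment (by omega) h1 hmm
    have := @H.edge_injOn
    have := @H.injOn
    simp [List.nodup_append', List.disjoint_left, inl_mem_incSegment, inr_mem_incSegment, h1, hi]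
    and_intros <;> grind -ext
  · intro e he
    simp [inr_mem_incSegment, h1, hi] at he
    have := H.mem
    grind -ext

theorem isIncPath_extend (H : IsBergeCore E m v h) (hi : 1 ≤ i) (hij : i < j) (hjm : j + 1 < m)
    (hi0 : v (i + 1) ∈ h 0) (hzi : z ∈ h i) (hzj : z ∈ h j)
    (hzv : ∀ t, 1 ≤ t → t < m → z ≠ v t)
    (hy : y ∈ h (m - 1)) (hyv : ∀ t, 1 ≤ t → t < m → y ≠ v t) (hyz : y ≠ z)
    (hgE : g ∈ E) (hg : ∀ t, t < m → g ≠ h t) (hjg : v j ∈ g) (hwg : w ∈ g)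
    (hwv : ∀ t, 1 ≤ t → t < m → w ≠ v t) (hwz : w ≠ z) (hwy : w ≠ y) :
    IsIncPath E (.inl w :: .inr g :: ((incSegment v h (i + 1) j).reverse ++ .inr (h 0) ::
      (incSegment v h 1 i ++ .inr (h i) :: .inl z :: .inr (h j) ::
      (incSegment v h (j + 1) (m - 1) ++ [.inr (h (m - 1)), .inl y])))) := by
  have hmm : m - 1 < m := by omega
  have h1 : j + 1 ≤ m - 1 := by omega
  have h2 : i + 1 ≤ j := hij
  refine ⟨?_, ?_, ?_⟩
  · rw [List.isChain_cons_cons, List.isChain_cons, List.isChain_append, List.isChain_cons,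
      List.isChain_append, List.isChain_cons_cons, List.isChain_cons_cons, List.isChain_cons,
      List.isChain_append]
    refine ⟨hwg, ?_, H.isChain_reverse_segment (by omega) h2 (by omega),
      ⟨?_, H.isChain_segment le_rfl hi (by omega), ⟨hzi, hzj, ?_,
      H.isChain_segment (by omega) h1 hmm, by simpa, ?_⟩, ?_⟩, ?_⟩
    · simpa [List.head?_append, getLast?_incSegment h2] using hjg
    · simpa [List.head?_append, head?_incSegment] using H.mem_right 0 (by omega)
    · simpa [List.head?_append, head?_incSegment] using H.mem_right j (by omega)
    · simpa [getLast?_incSegment h1] using H.mem_left _ (by omega) hmm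
    · simpa [getLast?_incSegment hi] using H.mem_left i hi (by omega)
    · simpa [List.getLast?_reverse, head?_incSegment] using hi0
  · have := H.nodup_segment (by omega) h2 (by omega)
    have := H.nodup_segment le_rfl hi (by omega)
    have := H.nodup_segment (by omega) h1 hmm
    have := @H.edge_injOn
    have := @H.injOn
    simp [List.nodup_append', List.disjoint_left, inl_mem_incSegment, inr_mem_incSegment, h1, hi,
      h2]
    and_intros <;> grind -ext
  · intro e he
    simp [inr_mem_incSegment, h1, hi, h2] at he
    have := H.mem
    grind -ext

end IsBergeCore

theorem IsIncPath.concat {E : Finset (Finset V)} {P : List (V ⊕ Finset V)} (hP : IsIncPath E P)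
    {e : Finset V} (hlast : P.getLast? = some (.inr e)) {y : V} (hy : y ∈ e)
    (hyP : Sum.inl y ∉ P) : IsIncPath E (P ++ [.inl y]) := by
  refine ⟨?_, ?_, ?_⟩
  · rw [List.isChain_append, hlast]
    exact ⟨hP.isChain, by simp, by simpa using hy⟩
  · simpa [List.nodup_append', hP.nodup] using hyP
  · intro f hf
    exact hP.mem_of_mem f (by simpa using hf)

theorem IsIncPath.cycleChain {E : Finset (Finset V)} {P : List (V ⊕ Finset V)}
    (hP : IsIncPath E P) {e : Finset V} (hlast : P.getLast? = some (.inr e)) {z : V}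
    (hhead : P.head? = some (.inl z)) (hz : z ∈ e) :
    Cycle.Chain Incident (P : Cycle (V ⊕ Finset V)) := by
  rcases P with _ | ⟨a, P⟩
  · simp at hhead
  · simp only [List.head?_cons, Option.some.injEq] at hhead
    subst hhead
    rw [Cycle.chain_coe_cons, ← List.cons_append, List.isChain_append, hlast]
    exact ⟨hP.isChain, by simp, by simpa using hz⟩

/-- The vertex `a` is covered by `E`, and only by members of `F`. -/
def IsCoveredOnlyBy (E F : Finset (Finset V)) (a : V) : Prop :=
  (∃ e ∈ E, a ∈ e) ∧ ∀ e ∈ E, a ∈ e → e ∈ F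

theorem exists_isCoveredOnlyBy_of_cycle [DecidableEq V] {E : Finset (Finset V)} {r m : ℕ}
    (hE : ∀ e ∈ E, e.card = r) (hm : 1 ≤ m) (hmr : m + 1 ≤ r) (hno : ¬ HasBergePath E (m + 1))
    {F : Finset (Finset V)} (hF : F.card = m)
    {C : List (V ⊕ Finset V)} (h : IsIncPath E C) (hl : C.length = 2 * m)
    (hcyc : Cycle.Chain Incident (C : Cycle (V ⊕ Finset V)))
    (hCF : ∀ f, Sum.inr f ∈ C ↔ f ∈ F) :
    ∃ A : Finset V, (∀ a ∈ A, IsCoveredOnlyBy E F a) ∧ r ≤ A.card ∧ (2 ≤ m → r + 1 ≤ A.card) := by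
  have hFE : ∀ f ∈ F, f ∈ E := fun f hf => h.mem_of_mem f ((hCF f).2 hf)
  have hsub : ∀ f ∈ F, f ⊆ F.biUnion id := fun f hf => Finset.subset_biUnion_of_mem id hf
  refine ⟨F.biUnion id, ?_, ?_, ?_⟩
  · intro a ha
    obtain ⟨e, he, hae⟩ := Finset.mem_biUnion.1 ha
    exact ⟨⟨e, hFE e he, hae⟩, fun f hf haf =>
      (hCF f).1 (h.inr_mem_of_cycle hE hm hmr hno hl hcyc ((hCF e).2 he) hae hf haf)⟩
  · obtain ⟨f, hf⟩ := Finset.card_pos.1 (by omega : 0 < F.card)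
    exact (hE f (hFE f hf)).symm.le.trans (Finset.card_le_card (hsub f hf))
  · intro hm2
    obtain ⟨f, hf, g, hg, hfg⟩ := Finset.one_lt_card.1 (by omega : 1 < F.card)
    by_contra! hcon
    have hf' := Finset.eq_of_subset_of_card_le (hsub f hf) (by rw [hE f (hFE f hf)]; omega)
    have hg' := Finset.eq_of_subset_of_card_le (hsub g hg) (by rw [hE g (hFE g hg)]; omega)
    exact hfg (hf'.trans hg'.symm)

theorem IsBergeCore.exists_isCoveredOnlyBy [DecidableEq V] {E : Finset (Finset V)} {r m : ℕ}
    (hE : ∀ e ∈ E, e.card = r) (hm : 2 ≤ m) (hmr : m + 1 ≤ r) (hno : ¬ HasBergePath E (m + 1))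
    {v : ℕ → V} {h : ℕ → Finset V} (H : IsBergeCore E m v h) :
    ∃ A : Finset V, (∀ a ∈ A, IsCoveredOnlyBy E ((Finset.range m).image h) a) ∧
      r + 1 ≤ A.card := by
  set F := (Finset.range m).image h with hFdef
  have hF : F.card = m := by
    rw [hFdef, Finset.card_image_of_injOn, Finset.card_range]
    intro i hi j hj hij
    exact H.edge_injOn (by simpa using hi) (by simpa using hj) hij
  have hmemF : ∀ f, f ∈ F ↔ ∃ t, t < m ∧ h t = f := by simp [hFdef]
  by_cases hcyc : ∃ C, IsIncPath E C ∧ C.length = 2 * m ∧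
      Cycle.Chain Incident (C : Cycle (V ⊕ Finset V)) ∧ ∀ f, Sum.inr f ∈ C ↔ f ∈ F
  · obtain ⟨C, h1, h2, h3, h4⟩ := hcyc
    obtain ⟨A, hA, -, hcard⟩ :=
      exists_isCoveredOnlyBy_of_cycle hE (by omega) hmr hno hF h1 h2 h3 h4
    exact ⟨A, hA, hcard hm⟩
  set core := (Finset.Ico 1 m).image v with hcore
  have hcore_card : core.card ≤ m - 1 := by
    simpa using Finset.card_image_le (s := Finset.Ico 1 m) (f := v)
  have hmem_core : ∀ x, x ∈ core ↔ ∃ t, 1 ≤ t ∧ t < m ∧ v t = x := by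
    simp [hcore, and_assoc]
  have hnc : ∀ x, x ∉ core → ∀ t, 1 ≤ t → t < m → x ≠ v t := fun x hx t h1 h2 h3 =>
    hx ((hmem_core x).2 ⟨t, h1, h2, h3.symm⟩)
  have hdiff : ∀ e ∈ E, r - (m - 1) ≤ (e \ core).card := fun e he => by
    have := Finset.le_card_sdiff core e
    rw [hE e he] at this
    omega
  have hne : ∀ e ∈ E, (e \ core).Nonempty := fun e he => by
    have := hdiff e he
    exact Finset.card_pos.1 (by omega)
  have hlastE := H.mem (m - 1) (by omega)
  obtain ⟨y₀, hy₀⟩ := hne _ hlastE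
  have hends : ∀ (P : List (V ⊕ Finset V)) (z : V), IsIncPath E P → P.length = 2 * m →
      P.head? = some (.inl z) → P.getLast? = some (.inr (h (m - 1))) → z ∉ core →
      (∀ u, Sum.inl u ∈ P → u = z ∨ u ∈ core) → (∀ f, Sum.inr f ∈ P ↔ f ∈ F) →
      z ∉ h (m - 1) ∧ (∀ e ∈ E, z ∈ e → e ∈ F) ∧
      ∀ y ∈ h (m - 1) \ core, ∀ e ∈ E, y ∈ e → e ∈ F := by
    intro P z hP hlen hhead hlast hz hPv hPF
    have hzl : z ∉ h (m - 1) := fun hzl =>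
      hcyc ⟨P, hP, hlen, hP.cycleChain hlast hhead hzl, hPF⟩
    have hpath : ∀ y ∈ h (m - 1) \ core, IsIncPath E (P ++ [.inl y]) := by
      intro y hy
      rw [Finset.mem_sdiff] at hy
      refine hP.concat hlast hy.1 fun hyP => ?_
      rcases hPv y hyP with rfl | h1
      · exact hzl hy.1
      · exact hy.2 h1
    refine ⟨hzl, fun e he hze => ?_, fun y hy e he hye => ?_⟩
    · have := (hpath y₀ hy₀).inr_mem_of_head hE (by omega) hmr hno (by simp [hlen])
        (x := z) (by simp [List.head?_append, hhead]) he hze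
      rw [← hPF]
      simpa using this
    · have := (hpath y hy).reverse.inr_mem_of_head hE (by omega) hmr hno (by simp [hlen])
        (x := y) (by simp) he hye
      rw [← hPF]
      simpa using this
  have hX : ∀ x ∈ h 0 \ core, x ∉ h (m - 1) ∧ (∀ e ∈ E, x ∈ e → e ∈ F) ∧
      ∀ y ∈ h (m - 1) \ core, ∀ e ∈ E, y ∈ e → e ∈ F := by
    intro x hx
    rw [Finset.mem_sdiff] at hx
    refine hends _ x (H.isIncPath_first hm hx.1 (hnc x hx.2)) ?_ (by simp) ?_ hx.2 ?_ ?_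
    · simp [length_incSegment]
      omega
    · simp [List.getLast?_cons]
    · intro u hu
      simp [inl_mem_incSegment (by omega : 1 ≤ m - 1)] at hu
      rw [hmem_core]
      rcases hu with rfl | ⟨t, h1, h2, rfl⟩
      · exact .inl rfl
      · exact .inr ⟨t, by omega, by omega, rfl⟩
    · intro f
      simp [inr_mem_incSegment (by omega : 1 ≤ m - 1)]
      rw [hmemF]
      constructor
      · rintro (rfl | ⟨t, h1, h2, rfl⟩ | rfl)
        · exact ⟨0, by omega, rfl⟩
        · exact ⟨t, by omega, rfl⟩
        · exact ⟨m - 1, by omega, rfl⟩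
      · rintro ⟨t, ht, rfl⟩
        rcases Nat.eq_zero_or_pos t with rfl | h1
        · exact .inl rfl
        · rcases (by omega : t = m - 1 ∨ t < m - 1) with rfl | h2
          · exact .inr (.inr rfl)
          · exact .inr (.inl ⟨t, h1, h2, rfl⟩)
  have hZ : ∀ i, 1 ≤ i → i + 1 < m → v (i + 1) ∈ h 0 → ∀ z ∈ h i \ core,
      z ∉ h (m - 1) ∧ (∀ e ∈ E, z ∈ e → e ∈ F) := by
    intro i hi him hi0 z hz
    rw [Finset.mem_sdiff] at hz
    have h1m : i + 1 ≤ m - 1 := by omega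
    have := hends _ z (H.isIncPath_rotate hi him hi0 hz.1 (hnc z hz.2)) ?_ (by simp) ?_ hz.2 ?_ ?_
    · exact ⟨this.1, this.2.1⟩
    · simp [length_incSegment]
      omega
    · simp [List.getLast?_cons, List.getLast?_append]
    · intro u hu
      simp [inl_mem_incSegment, hi, h1m] at hu
      rw [hmem_core]
      rcases hu with rfl | ⟨t, h1, h2, rfl⟩ | ⟨t, h1, h2, rfl⟩
      · exact .inl rfl
      · exact .inr ⟨t, by omega, by omega, rfl⟩
      · exact .inr ⟨t, by omega, by omega, rfl⟩
    · intro f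
      simp [inr_mem_incSegment, hi, h1m]
      rw [hmemF]
      constructor
      · rintro (rfl | ⟨t, h1, h2, rfl⟩ | rfl | ⟨t, h1, h2, rfl⟩ | rfl)
        · exact ⟨i, by omega, rfl⟩
        · exact ⟨t, by omega, rfl⟩
        · exact ⟨0, by omega, rfl⟩
        · exact ⟨t, by omega, rfl⟩
        · exact ⟨m - 1, by omega, rfl⟩
      · rintro ⟨t, ht, rfl⟩
        rcases (by omega : t = i ∨ (1 ≤ t ∧ t < i) ∨ t = 0 ∨ (i + 1 ≤ t ∧ t < m - 1) ∨ t = m - 1)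
          with rfl | h1 | rfl | h1 | rfl
        · exact .inl rfl
        · exact .inr (.inl ⟨t, h1.1, h1.2, rfl⟩)
        · exact .inr (.inr (.inl rfl))
        · exact .inr (.inr (.inr (.inl ⟨t, h1.1, h1.2, rfl⟩)))
        · exact .inr (.inr (.inr (.inr rfl)))
  obtain ⟨x₀, hx₀⟩ := hne _ (H.mem 0 (by omega))
  have hY := (hX x₀ hx₀).2.2
  have hins : ∀ i, 1 ≤ i → i + 1 < m → ∀ z ∈ h i \ core, z ∈ h 0 →
      ∀ e ∈ E, v i ∈ e → e ∈ F := by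
    intro i hi him z hz hz0 e he hve
    rw [Finset.mem_sdiff] at hz hy₀
    have h1m : i + 1 ≤ m - 1 := by omega
    have hyz : y₀ ≠ z := by
      rintro rfl
      exact (hX y₀ (Finset.mem_sdiff.2 ⟨hz0, hz.2⟩)).1 hy₀.1
    have := (H.isIncPath_insert hi him hz0 hz.1 (hnc z hz.2) hy₀.1 (hnc _ hy₀.2)
      hyz).inr_mem_of_head hE (by omega) hmr hno (x := v i) ?_ ?_ he hve
    · simp [inr_mem_incSegment, hi, h1m] at this
      rw [hmemF]
      rcases this with ⟨t, h1, h2, rfl⟩ | rfl | rfl | ⟨t, h1, h2, rfl⟩ | rfl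
      · exact ⟨t, by omega, rfl⟩
      · exact ⟨0, by omega, rfl⟩
      · exact ⟨i, by omega, rfl⟩
      · exact ⟨t, by omega, rfl⟩
      · exact ⟨m - 1, by omega, rfl⟩
    · simp [length_incSegment]
      omega
    · simp [List.head?_append, getLast?_incSegment hi]
  have hdisj : ∀ i j, 1 ≤ i → i < j → j + 1 < m → v (i + 1) ∈ h 0 → (∃ g ∈ E, v j ∈ g ∧ g ∉ F) →
      ∀ z ∈ h i \ core, z ∉ h j := by
    rintro i j hi hij hjm hi0 ⟨g, hgE, hjg, hgF⟩ z hz hzj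
    have hzZ := hZ i hi (by omega) hi0 z hz
    obtain ⟨w, hw⟩ := hne g hgE
    rw [Finset.mem_sdiff] at hz hw
    have hyz : y₀ ≠ z := by
      rintro rfl
      exact hzZ.1 (Finset.mem_sdiff.1 hy₀).1
    have hwz : w ≠ z := by
      rintro rfl
      exact hgF (hzZ.2 g hgE hw.1)
    have hwy : w ≠ y₀ := by
      rintro rfl
      exact hgF (hY w hy₀ g hgE hw.1)
    rw [Finset.mem_sdiff] at hy₀
    have := H.isIncPath_extend hi hij hjm hi0 hz.1 hzj (hnc z hz.2) hy₀.1 (hnc _ hy₀.2) hyz hgE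
      (fun t ht hgt => hgF ((hmemF g).2 ⟨t, ht, hgt.symm⟩)) hjg hw.1 (hnc w hw.2) hwz hwy
    refine hno (this.hasBergePath (x := w) rfl ?_)
    simp [length_incSegment]
    omega
  set I := (Finset.Ico 1 (m - 1)).filter fun i => v (i + 1) ∈ h 0 with hI
  have hmemI : ∀ i, i ∈ I ↔ 1 ≤ i ∧ i + 1 < m ∧ v (i + 1) ∈ h 0 := by
    intro i
    simp only [hI, Finset.mem_filter, Finset.mem_Ico]
    constructor
    · rintro ⟨⟨a, b⟩, c⟩
      exact ⟨a, by omega, c⟩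
    · rintro ⟨a, b, c⟩
      exact ⟨⟨a, by omega⟩, c⟩
  have hφ : ∀ i : ℕ, ∃ a : V, i ∈ I →
      ((a = v i ∧ ∀ e ∈ E, v i ∈ e → e ∈ F) ∨
        (a ∈ h i \ core ∧ ∃ g ∈ E, v i ∈ g ∧ g ∉ F)) := by
    intro i
    by_cases hi : i ∈ I
    · by_cases hg : ∀ e ∈ E, v i ∈ e → e ∈ F
      · exact ⟨v i, fun _ => .inl ⟨rfl, hg⟩⟩
      · push Not at hg
        obtain ⟨a, ha⟩ := hne (h i) (H.mem i (by have := (hmemI i).1 hi; omega))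
        exact ⟨a, fun _ => .inr ⟨ha, hg⟩⟩
    · exact ⟨v 0, fun h => absurd h hi⟩
  choose φ hφ using hφ
  have hvcore : ∀ i ∈ I, v i ∈ core := fun i hi => by
    have := (hmemI i).1 hi
    exact (hmem_core _).2 ⟨i, by omega, by omega, rfl⟩
  have hφ_lt : ∀ i ∈ I, ∀ j ∈ I, i < j → φ i ≠ φ j := by
    intro i hi j hj hij heq
    have hi' := (hmemI i).1 hi
    have hj' := (hmemI j).1 hj
    rcases hφ i hi with ⟨h1, -⟩ | ⟨h1, -⟩ <;> rcases hφ j hj with ⟨h2, -⟩ | ⟨h2, h3⟩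
    · exact H.ne i j hi'.1 hij (by omega) (h1.symm.trans (heq.trans h2))
    · rw [← heq, h1] at h2
      exact (Finset.mem_sdiff.1 h2).2 (hvcore i hi)
    · rw [heq, h2] at h1
      exact (Finset.mem_sdiff.1 h1).2 (hvcore j hj)
    · refine hdisj i j hi'.1 hij hj'.2.1 hi'.2.2 h3 _ h1 ?_
      rw [heq]
      exact (Finset.mem_sdiff.1 h2).1
  have hφ_inj : Set.InjOn φ I := by
    intro i hi j hj hij
    rcases lt_trichotomy i j with h1 | h1 | h1
    · exact absurd hij (hφ_lt i hi j hj h1)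
    · exact h1
    · exact absurd hij.symm (hφ_lt j hj i hi h1)
  have hdXY : Disjoint (h 0 \ core) (h (m - 1) \ core) := by
    rw [Finset.disjoint_left]
    intro x hx hy
    exact (hX x hx).1 (Finset.mem_sdiff.1 hy).1
  have hdφ : Disjoint (h 0 \ core ∪ h (m - 1) \ core) (I.image φ) := by
    rw [Finset.disjoint_right]
    intro a ha
    obtain ⟨i, hi, rfl⟩ := Finset.mem_image.1 ha
    have hi' := (hmemI i).1 hi
    rcases hφ i hi with ⟨h1, -⟩ | ⟨h1, g, hgE, hg, hgF⟩
    · have := hvcore i hi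
      simp [h1, this]
    · have h2 := (hZ i hi'.1 hi'.2.1 hi'.2.2 _ h1).1
      have h3 : φ i ∉ h 0 := fun h0 => hgF (hins i hi'.1 hi'.2.1 _ h1 h0 g hgE hg)
      simp [h2, h3]
  have hXcard : r ≤ (h 0 \ core).card + I.card + 1 := by
    have h1 : h 0 ∩ core ⊆ insert (v 1) (I.image fun i => v (i + 1)) := by
      intro x hx
      rw [Finset.mem_inter, hmem_core] at hx
      obtain ⟨hx0, t, ht1, htm, rfl⟩ := hx
      rw [Finset.mem_insert, Finset.mem_image]
      rcases (by omega : t = 1 ∨ 2 ≤ t) with rfl | ht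
      · exact .inl rfl
      · refine .inr ⟨t - 1, (hmemI _).2 ⟨by omega, by omega, ?_⟩, ?_⟩ <;>
          rw [Nat.sub_add_cancel ht1]
        exact hx0
    have h2 := (Finset.card_le_card h1).trans (Finset.card_insert_le _ _)
    have h3 := Finset.card_image_le (s := I) (f := fun i => v (i + 1))
    have h4 := Finset.card_sdiff_add_card_inter (h 0) core
    rw [hE _ (H.mem 0 (by omega))] at h4
    omega
  refine ⟨(h 0 \ core ∪ h (m - 1) \ core) ∪ I.image φ, ?_, ?_⟩
  · intro a ha
    rw [Finset.mem_union, Finset.mem_union] at ha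
    rcases ha with (ha | ha) | ha
    · exact ⟨⟨_, H.mem 0 (by omega), (Finset.mem_sdiff.1 ha).1⟩, (hX a ha).2.1⟩
    · exact ⟨⟨_, hlastE, (Finset.mem_sdiff.1 ha).1⟩, hY a ha⟩
    · obtain ⟨i, hi, rfl⟩ := Finset.mem_image.1 ha
      have hi' := (hmemI i).1 hi
      rcases hφ i hi with ⟨h1, h2⟩ | ⟨h1, -⟩
      · rw [h1]
        exact ⟨⟨_, H.mem i (by omega), H.mem_left i hi'.1 (by omega)⟩, h2⟩
      · exact ⟨⟨_, H.mem i (by omega), (Finset.mem_sdiff.1 h1).1⟩,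
          (hZ i hi'.1 hi'.2.1 hi'.2.2 _ h1).2⟩
  · rw [Finset.card_union_of_disjoint hdφ, Finset.card_union_of_disjoint hdXY,
      Finset.card_image_of_injOn hφ_inj]
    have := hdiff _ hlastE
    omega

theorem exists_isCoveredOnlyBy [DecidableEq V] {E : Finset (Finset V)} {r k : ℕ}
    (hE : ∀ e ∈ E, e.card = r) (hk : 3 ≤ k) (hkr : k ≤ r) (hno : ¬ HasBergePath E k)
    (hne : E.Nonempty) :
    ∃ (A : Finset V) (F : Finset (Finset V)), (∀ a ∈ A, IsCoveredOnlyBy E F a) ∧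
      ((r + 1 ≤ A.card ∧ F.card ≤ k - 1) ∨ (r ≤ A.card ∧ F.card ≤ 1)) := by
  have hex : ∃ m, ¬ HasBergePath E (m + 1) := ⟨k - 1, by rwa [Nat.sub_add_cancel (by omega)]⟩
  classical
  obtain ⟨m, hm, hmin⟩ : ∃ m, ¬ HasBergePath E (m + 1) ∧ ∀ j < m, HasBergePath E (j + 1) :=
    ⟨Nat.find hex, Nat.find_spec hex, fun j hj => not_not.1 (Nat.find_min hex hj)⟩
  have hmk : m ≤ k - 1 := by
    by_contra! hcon
    have := hmin (k - 1) hcon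
    rw [Nat.sub_add_cancel (by omega)] at this
    exact hno this
  obtain ⟨e, he⟩ := hne
  have hm1 : m ≠ 0 := by
    rintro rfl
    obtain ⟨x, hx, y, hy, hxy⟩ := Finset.one_lt_card.1 (by rw [hE e he]; omega : 1 < e.card)
    refine hm ⟨![x, y], ![e], ?_, ?_, ?_, ?_⟩
    · intro i j hij
      fin_cases i <;> fin_cases j <;> simp_all
    · intro i j _
      exact Subsingleton.elim (α := Fin 1) i j
    · simpa using he
    · intro i
      fin_cases i
      simp [hx, hy]
  rcases (by omega : m = 1 ∨ 2 ≤ m) with rfl | hm2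
  · obtain ⟨x, hx⟩ := Finset.card_pos.1 (by rw [hE e he]; omega : 0 < e.card)
    obtain ⟨A, hA, hr, -⟩ := exists_isCoveredOnlyBy_of_cycle (F := {e}) (C := [.inl x, .inr e]) hE
      le_rfl (by omega) hm (by simp) ⟨by simpa using hx, by simp, by simpa using he⟩ (by simp)
      (by simp [Incident, hx]) (by simp)
    exact ⟨A, {e}, hA, .inr ⟨hr, by simp⟩⟩
  · obtain ⟨v, h, hv, hh, hmem, hvh⟩ := hmin (m - 1) (by omega)
    have hmm : m - 1 + 1 = m := Nat.sub_add_cancel (by omega)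
    have H : IsBergeCore E m (fun t => if ht : t < m - 1 + 1 + 1 then v ⟨t, ht⟩ else v 0)
        (fun t => if ht : t < m - 1 + 1 then h ⟨t, ht⟩ else h 0) := by
      refine ⟨fun t h1 h2 => ?_, fun t h1 => ?_, fun s t h1 h2 h3 => ?_, fun s t h1 h2 => ?_,
        fun t h1 => ?_⟩
      · have := (hvh ⟨t, by omega⟩).1
        simpa [(by omega : t < m - 1 + 1), (by omega : t < m - 1 + 1 + 1)] using this
      · have := (hvh ⟨t, by omega⟩).2
        simpa [(by omega : t < m - 1 + 1), (by omega : t + 1 < m - 1 + 1 + 1)] using this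
      · rw [dif_pos (by omega), dif_pos (by omega)]
        intro h4
        have := congrArg Fin.val (hv h4)
        simp at this
        omega
      · rw [dif_pos (by omega), dif_pos (by omega)]
        intro h4
        have := congrArg Fin.val (hh h4)
        simp at this
        omega
      · rw [dif_pos (by omega)]
        exact hmem _
    obtain ⟨A, hA, hr⟩ := H.exists_isCoveredOnlyBy hE hm2 (by omega) hm
    refine ⟨A, _, hA, .inl ⟨hr, Finset.card_image_le.trans ?_⟩⟩
    simpa using hmk

theorem HasBergePath.mono {E E' : Finset (Finset V)} {k : ℕ} (hEE : E' ⊆ E)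
    (h : HasBergePath E' k) : HasBergePath E k := by
  obtain ⟨v, g, hv, hg, hm, hvg⟩ := h
  exact ⟨v, g, hv, hg, fun i => hEE (hm i), hvg⟩

/-- The Turán number of the Berge path of length `k` in `r`-uniform hypergraphs on `n`
vertices, for `3 ≤ k ≤ r`. -/
def bergePathTuran (r k n : ℕ) : ℕ :=
  n / (r + 1) * (k - 1) + if (r + 1) ∣ (n + 1) then 1 else 0

theorem succ_div_eq_of_dvd {r n : ℕ} (h : (r + 1) ∣ (n + 1)) :
    (n + 1) / (r + 1) = n / (r + 1) + 1 := by
  rw [Nat.succ_div, if_pos h]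

theorem bergePathTuran_mono {r k : ℕ} (hk : 2 ≤ k) : Monotone (bergePathTuran r k) := by
  refine monotone_nat_of_le_succ fun n => ?_
  unfold bergePathTuran
  rw [Nat.succ_div]
  split_ifs with h1 h2
  · nlinarith [Nat.zero_le (n / (r + 1)), (by omega : 1 ≤ k - 1)]
  · nlinarith [Nat.zero_le (n / (r + 1)), (by omega : 1 ≤ k - 1)]
  · simp
  · simp

theorem bergePathTuran_add (r k n : ℕ) :
    bergePathTuran r k (n + (r + 1)) = bergePathTuran r k n + (k - 1) := by
  unfold bergePathTuran
  have h : n + (r + 1) + 1 = n + 1 + (r + 1) := by ring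
  simp only [Nat.add_div_right _ (Nat.succ_pos r), h, Nat.dvd_add_self_right]
  rw [Nat.succ_mul]
  exact Nat.add_right_comm _ _ _

theorem bergePathTuran_add_one_le {r k : ℕ} (hr : 1 ≤ r) (hk : 3 ≤ k) (n : ℕ) :
    bergePathTuran r k n + 1 ≤ bergePathTuran r k (n + r) := by
  have h : bergePathTuran r k (n + r + 1) = bergePathTuran r k n + (k - 1) :=
    bergePathTuran_add r k n
  have h1 : (n + r + 1) / (r + 1) = n / (r + 1) + 1 := Nat.add_div_right _ (Nat.succ_pos r)
  by_cases hd : (r + 1) ∣ (n + r + 1)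
  · have h2 := succ_div_eq_of_dvd hd
    have h3 : (n + r) / (r + 1) = n / (r + 1) := by omega
    have h4 : ¬ (r + 1) ∣ (n + 1) := by
      intro hcon
      have h5 := (Nat.dvd_sub hd hcon)
      rw [(by omega : n + r + 1 - (n + 1) = r)] at h5
      have := Nat.le_of_dvd (by omega) h5
      omega
    simp [bergePathTuran, h3, hd, h4]
  · have h2 : (n + r) / (r + 1) = n / (r + 1) + 1 := by
      rw [← h1, Nat.succ_div, if_neg hd, add_zero]
    have h3 : (k - 1) = (k - 2) + 1 := by omega
    unfold bergePathTuran
    rw [h2, add_mul, one_mul]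
    split_ifs <;> omega

theorem card_le_bergePathTuran [DecidableEq V] {r k : ℕ} (hk : 3 ≤ k) (hkr : k ≤ r)
    (S : Finset V) (E : Finset (Finset V)) (hE : ∀ e ∈ E, e.card = r) (hES : ∀ e ∈ E, e ⊆ S)
    (hno : ¬ HasBergePath E k) : E.card ≤ bergePathTuran r k S.card := by
  induction S using Finset.strongInduction generalizing E with
  | H S ih =>
  rcases E.eq_empty_or_nonempty with rfl | hne
  · simp
  obtain ⟨A, F, hA, hAF⟩ := exists_isCoveredOnlyBy hE hk hkr hno hne
  have hAS : A ⊆ S := fun a ha => by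
    obtain ⟨⟨e, he, hae⟩, -⟩ := hA a ha
    exact hES e he hae
  have hApos : A.Nonempty := Finset.card_pos.1 (by omega)
  have hrec := ih (S \ A) (Finset.sdiff_ssubset hAS hApos) (E \ F)
    (fun e he => hE e (Finset.mem_sdiff.1 he).1)
    (fun e he => by
      rw [Finset.mem_sdiff] at he
      intro x hx
      exact Finset.mem_sdiff.2 ⟨hES e he.1 hx, fun hxA => he.2 ((hA x hxA).2 e he.1 hx)⟩)
    (fun h => hno (h.mono Finset.sdiff_subset))
  have hcard : E.card ≤ (E \ F).card + F.card := by
    have := Finset.le_card_sdiff F E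
    omega
  have hSA : (S \ A).card + A.card = S.card := Finset.card_sdiff_add_card_eq_card hAS
  rcases hAF with ⟨h1, h2⟩ | ⟨h1, h2⟩
  · have h3 := bergePathTuran_add r k (S \ A).card
    have h4 := bergePathTuran_mono (r := r) (by omega : 2 ≤ k)
      (by omega : (S \ A).card + (r + 1) ≤ S.card)
    omega
  · have h3 := bergePathTuran_add_one_le (by omega : 1 ≤ r) hk (S \ A).card
    have h4 := bergePathTuran_mono (r := r) (by omega : 2 ≤ k)
      (by omega : (S \ A).card + r ≤ S.card)
    omega

end IncidencePaths

section Construction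

variable {r k n b j : ℕ}

/-- The vertices of the `b`-th block of `r + 1` consecutive vertices, without its `j`-th one. -/
def blockEdge (r n b j : ℕ) : Finset (Fin n) :=
  Finset.univ.filter fun x => x.val / (r + 1) = b ∧ x.val % (r + 1) ≠ j

theorem mem_blockEdge {x : Fin n} :
    x ∈ blockEdge r n b j ↔ x.val / (r + 1) = b ∧ x.val % (r + 1) ≠ j := by
  simp [blockEdge]

theorem mk_mem_blockEdge {s : ℕ} (hs : s ≤ r) (hsj : s ≠ j) (h : b * (r + 1) + s < n) :
    (⟨b * (r + 1) + s, h⟩ : Fin n) ∈ blockEdge r n b j := by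
  have h1 : s < r + 1 := by omega
  rw [mem_blockEdge]
  refine ⟨?_, ?_⟩
  · simp [Nat.mul_comm b, Nat.mul_add_div, Nat.div_eq_of_lt h1]
  · simpa [Nat.mul_comm b, Nat.mul_add_mod, Nat.mod_eq_of_lt h1] using hsj

theorem card_blockEdge (hj : j ≤ r) (h : ∀ s ≤ r, s ≠ j → b * (r + 1) + s < n) :
    (blockEdge r n b j).card = r := by
  have hr : ((Finset.range (r + 1)).erase j).card = r := by
    rw [Finset.card_erase_of_mem (by simpa using Nat.lt_succ_of_le hj), Finset.card_range,
      Nat.add_sub_cancel]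
  refine Eq.trans (Finset.card_bij (fun x _ => x.val % (r + 1)) ?_ ?_ ?_) hr
  · intro x hx
    rw [mem_blockEdge] at hx
    simpa [hx.2] using Nat.lt_succ_iff.1 (Nat.mod_lt x.val (Nat.succ_pos r))
  · intro x hx y hy hxy
    rw [mem_blockEdge] at hx hy
    apply Fin.ext
    rw [← Nat.div_add_mod x.val (r + 1), ← Nat.div_add_mod y.val (r + 1), hx.1, hy.1, hxy]
  · intro s hs
    simp only [Finset.mem_erase, Finset.mem_range] at hs
    refine ⟨⟨b * (r + 1) + s, h s (by omega) hs.1⟩, mk_mem_blockEdge (by omega) hs.1 _, ?_⟩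
    simp [Nat.mul_comm b, Nat.mod_eq_of_lt hs.2]

/-- The indices of the blocks and omitted vertices used in the extremal hypergraph. -/
def blockIndex (r k n : ℕ) : Finset (ℕ × ℕ) :=
  Finset.range (n / (r + 1)) ×ˢ Finset.range (k - 1) ∪
    if (r + 1) ∣ (n + 1) then {(n / (r + 1), r)} else ∅

theorem mem_blockIndex {p : ℕ × ℕ} : p ∈ blockIndex r k n ↔
    (p.1 < n / (r + 1) ∧ p.2 < k - 1) ∨
      ((r + 1) ∣ (n + 1) ∧ p.1 = n / (r + 1) ∧ p.2 = r) := by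
  unfold blockIndex
  split_ifs with h <;> simp [h, Prod.ext_iff, or_comm]

theorem card_blockIndex : (blockIndex r k n).card = bergePathTuran r k n := by
  unfold blockIndex bergePathTuran
  rw [Finset.card_union_of_disjoint]
  · split_ifs <;> simp
  · split_ifs <;> simp

theorem snd_le_of_mem_blockIndex (hkr : k ≤ r) {p : ℕ × ℕ} (hp : p ∈ blockIndex r k n) :
    p.2 ≤ r := by
  rw [mem_blockIndex] at hp
  omega

theorem lt_of_mem_blockIndex {p : ℕ × ℕ} (hp : p ∈ blockIndex r k n) {s : ℕ} (hs : s ≤ r)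
    (hsp : s ≠ p.2) : p.1 * (r + 1) + s < n := by
  have h1 := Nat.div_add_mod n (r + 1)
  rw [mem_blockIndex] at hp
  rcases hp with ⟨h2, -⟩ | ⟨h2, h3, h4⟩
  · have h5 := Nat.mul_le_mul_right (r + 1) h2
    rw [Nat.mul_comm] at h1
    rw [Nat.succ_mul] at h5
    omega
  · have h5 := Nat.div_mul_cancel h2
    rw [Nat.succ_div, if_pos h2, Nat.succ_mul, ← h3] at h5
    omega

theorem blockEdge_injOn (hr : 2 ≤ r) (hkr : k ≤ r) :
    Set.InjOn (fun p : ℕ × ℕ => blockEdge r n p.1 p.2) (blockIndex r k n) := by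
  intro p hp q hq hpq
  simp only [Finset.mem_coe] at hp hq hpq
  have hcard := card_blockEdge (snd_le_of_mem_blockIndex hkr hp)
    fun s hs hsp => lt_of_mem_blockIndex hp hs hsp
  obtain ⟨x, hx⟩ := Finset.card_pos.1 (by omega : 0 < (blockEdge r n p.1 p.2).card)
  have h1 : p.1 = q.1 := (mem_blockEdge.1 hx).1.symm.trans (mem_blockEdge.1 (hpq ▸ hx)).1
  refine Prod.ext h1 ?_
  by_contra h2
  have hq2 := snd_le_of_mem_blockIndex hkr hq
  have h3 := mk_mem_blockEdge hq2 (Ne.symm h2) (lt_of_mem_blockIndex hp hq2 (Ne.symm h2))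
  rw [hpq, mem_blockEdge] at h3
  refine h3.2 ?_
  simp [Nat.mul_comm p.1, Nat.mod_eq_of_lt (Nat.lt_succ_of_le hq2)]

theorem not_hasBergePath_blockEdge (hk : 2 ≤ k) :
    ¬ HasBergePath ((blockIndex r k n).image fun p => blockEdge r n p.1 p.2) k := by
  rintro ⟨v, h, -, hh, hmem, hvh⟩
  simp only [Finset.mem_image] at hmem
  choose p hp hph using hmem
  have hv1 : ∀ i : Fin k, (v i.castSucc).val / (r + 1) = (p i).1 := fun i =>
    (mem_blockEdge.1 ((hph i).symm ▸ (hvh i).1)).1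
  have hv2 : ∀ i : Fin k, (v i.succ).val / (r + 1) = (p i).1 := fun i =>
    (mem_blockEdge.1 ((hph i).symm ▸ (hvh i).2)).1
  have hv : ∀ i, (v i).val / (r + 1) = (v 0).val / (r + 1) := by
    intro i
    induction i using Fin.induction with
    | zero => rfl
    | succ i ih => rw [hv2, ← hv1, ih]
  have hp1 : ∀ i, (p i).1 = (v 0).val / (r + 1) := fun i => by rw [← hv1, hv]
  have hinj : Function.Injective fun i => (p i).2 := by
    intro i j hij
    apply hh
    rw [← hph i, ← hph j, hp1, hp1, show (p i).2 = (p j).2 from hij]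
  have hbound : ∀ J : Finset ℕ, (∀ i, (p i).2 ∈ J) → k ≤ J.card := by
    intro J hJ
    simpa using Finset.card_le_card_of_injOn (s := Finset.univ) (fun i => (p i).2)
      (fun i _ => hJ i) hinj.injOn
  by_cases hb : (v 0).val / (r + 1) < n / (r + 1)
  · have := hbound (Finset.range (k - 1)) fun i => by
      have h1 := mem_blockIndex.1 (hp i)
      have h2 := hp1 i
      rw [Finset.mem_range]
      omega
    rw [Finset.card_range] at this
    omega
  · have := hbound {r} fun i => by
      have h1 := mem_blockIndex.1 (hp i)
      have h2 := hp1 i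
      rw [Finset.mem_singleton]
      omega
    rw [Finset.card_singleton] at this
    omega

end Construction

/-- For `3 ≤ k ≤ r`, the maximum number of hyperedges of an `n`-vertex `r`-uniform
hypergraph with no Berge path of length `k` equals
`⌊n/(r+1)⌋·(k−1) + ε`, where `ε = 1` iff `r+1 ∣ n+1`. -/
theorem berge_path_turan_exact_small_k (r k n : ℕ) (hk : 3 ≤ k) (hkr : k ≤ r) :
    IsGreatest {m : ℕ | ∃ E : Finset (Finset (Fin n)),
        (∀ e ∈ E, e.card = r) ∧ ¬ HasBergePath E k ∧ E.card = m}
      (n / (r + 1) * (k - 1) + if (r + 1) ∣ (n + 1) then 1 else 0) := by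
  have hno := not_hasBergePath_blockEdge (r := r) (n := n) (by omega : 2 ≤ k)
  refine ⟨⟨_, ?_, hno, ?_⟩, ?_⟩
  · intro e he
    obtain ⟨p, hp, rfl⟩ := Finset.mem_image.1 he
    exact card_blockEdge (snd_le_of_mem_blockIndex hkr hp)
      fun s hs hsp => lt_of_mem_blockIndex hp hs hsp
  · rw [Finset.card_image_of_injOn (blockEdge_injOn (by omega) hkr), card_blockIndex,
      bergePathTuran]
  · rintro _ ⟨E, hE, hno, rfl⟩
    have h := card_le_bergePathTuran hk hkr Finset.univ E hE (fun e _ => Finset.subset_univ e) hno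
    rwa [Finset.card_univ, Fintype.card_fin, bergePathTuran] at h
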